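/- arXiv:2204.10706 — 2 statements merged into one kernel-verified Lean document; each statement's English description precedes it below -/
import Mathlib

section
/- There exist η > 0 (sufficiently small) and C > 0 such that for every r with 0 < r ≤ η, the matrix A₁(r) has three distinct eigenvalues λ₁(r), λ₂(r), λ₃(r) satisfying |λ₁(r) − (−((β₁β₃ν⁺+β₂β₄ν⁻)/(2(β₁β₃+β₂β₄)))r² + i√(β₁β₃+β₂β₄)·r)| ≤ Cr³, |λ₂(r) − (−((β₁β₃ν⁺+β₂β₄ν⁻)/(2(β₁β₃+β₂β₄)))r² − i√(β₁β₃+β₂β₄)·r)| ≤ Cr³, and |λ₃(r) − (−((β₁β₃ν⁻+β₂β₄ν⁺)/(β₁β₃+β₂β₄))r²)| ≤ Cr³. -/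
noncomputable section

/-- The matrix `A₁(r)` from the spectral analysis of the linearized two-fluid system:
rows `(0, −β₁r, −β₂r)`, `(β₃r, −ν⁺r², 0)`, `(β₄r, 0, −ν⁻r²)`. -/
def A1 (β₁ β₂ β₃ β₄ νp νm : ℝ) (r : ℝ) : Matrix (Fin 3) (Fin 3) ℂ :=
  !![0, (↑(-β₁ * r) : ℂ), (↑(-β₂ * r) : ℂ);
     (↑(β₃ * r) : ℂ), (↑(-νp * r ^ 2) : ℂ), 0;
     (↑(β₄ * r) : ℂ), 0, (↑(-νm * r ^ 2) : ℂ)]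

/-- A perturbed linear equation `ε x (x + p) (x + m) + s (x - x₀) = 0` has a root at distance
`O(ε)` from `x₀`. -/
lemma exists_root_perturbed_linear {p m s x₀ T ε : ℝ} (hs : 0 < s) (hT : 1 ≤ T)
    (hp : 0 < p) (hm : 0 < m) (hpm : p + m + 1 = T) (hl : -(p + m) ≤ x₀) (hu : x₀ ≤ 0)
    (hε : 0 ≤ ε) (hεT : T ^ 3 / s * ε ≤ 1) :
    ∃ x, |x - x₀| ≤ T ^ 3 / s * ε ∧ ε * (x * (x + p) * (x + m)) + s * (x - x₀) = 0 := by
  set d := T ^ 3 / s * ε with hd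
  have hT0 : 0 ≤ T := by linarith
  have hd0 : 0 ≤ d := by positivity
  have hsd : s * d = T ^ 3 * ε := by rw [hd]; field_simp
  have hbound : ∀ x, |x - x₀| ≤ 1 → |ε * (x * (x + p) * (x + m))| ≤ T ^ 3 * ε := by
    intro x hx
    obtain ⟨h1, h2⟩ := abs_le.1 hx
    have e1 : |x| ≤ T := abs_le.2 ⟨by linarith, by linarith⟩
    have e2 : |x + p| ≤ T := abs_le.2 ⟨by linarith, by linarith⟩
    have e3 : |x + m| ≤ T := abs_le.2 ⟨by linarith, by linarith⟩
    rw [abs_mul, abs_mul, abs_mul, abs_of_nonneg hε]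
    calc ε * (|x| * |x + p| * |x + m|) ≤ ε * (T * T * T) := by gcongr
      _ = T ^ 3 * ε := by ring
  have hlo := abs_le.1 (hbound (x₀ - d) (by rw [abs_le]; constructor <;> linarith))
  have hhi := abs_le.1 (hbound (x₀ + d) (by rw [abs_le]; constructor <;> linarith))
  have hcont : ContinuousOn (fun x => ε * (x * (x + p) * (x + m)) + s * (x - x₀))
      (Set.Icc (x₀ - d) (x₀ + d)) := by fun_prop
  obtain ⟨x, hx, hx0⟩ := intermediate_value_Icc (by linarith) hcont
    (show (0 : ℝ) ∈ Set.Icc _ _ from ⟨by linarith [hlo.2], by linarith [hhi.1]⟩)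
  exact ⟨x, abs_le.2 ⟨by linarith [hx.1], by linarith [hx.2]⟩, hx0⟩

lemma abs_sqrt_sub_sqrt_le {u s : ℝ} (hu : 0 ≤ u) (hs : 0 < s) :
    |√u - √s| ≤ |u - s| / √s := by
  have h0 : 0 < √s := Real.sqrt_pos.2 hs
  rw [le_div_iff₀ h0]
  have h : u - s = (√u - √s) * (√u + √s) := by
    linear_combination -Real.sq_sqrt hu + Real.sq_sqrt hs.le
  rw [h, abs_mul, abs_of_nonneg (add_nonneg (Real.sqrt_nonneg u) h0.le)]
  gcongr
  linarith [Real.sqrt_nonneg u]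

lemma det_smul_one_sub_A1 (β₁ β₂ β₃ β₄ νp νm r : ℝ) (l : ℂ) :
    Matrix.det (l • (1 : Matrix (Fin 3) (Fin 3) ℂ) - A1 β₁ β₂ β₃ β₄ νp νm r) =
      l * (l + νp * r ^ 2) * (l + νm * r ^ 2) + β₁ * β₃ * r ^ 2 * (l + νm * r ^ 2)
        + β₂ * β₄ * r ^ 2 * (l + νp * r ^ 2) := by
  simp [A1, Matrix.det_fin_three]
  ring

lemma cubic_eq_mul_quadratic {a b p m s x q w r l : ℂ} (hs : s = a + b) (hq : q = p + m + x)
    (hw : w ^ 2 = s + r ^ 2 * (p * m + x * q - q ^ 2 / 4))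
    (hroot : r ^ 2 * (x * (x + p) * (x + m)) + s * x + (a * m + b * p) = 0) :
    l * (l + p * r ^ 2) * (l + m * r ^ 2) + a * r ^ 2 * (l + m * r ^ 2)
        + b * r ^ 2 * (l + p * r ^ 2) =
      (l - x * r ^ 2) * ((l + q / 2 * r ^ 2) ^ 2 + (w * r) ^ 2) := by
  subst hs hq
  linear_combination r ^ 4 * hroot - (l - x * r ^ 2) * r ^ 2 * hw

lemma add_I_mul_quadratic {c v d : ℂ} (hc : c = -d) :
    (c + Complex.I * v + d) ^ 2 + v ^ 2 = 0 := by
  linear_combination (c + d + 2 * Complex.I * v) * hc + v ^ 2 * Complex.I_sq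

lemma sub_I_mul_quadratic {c v d : ℂ} (hc : c = -d) :
    (c - Complex.I * v + d) ^ 2 + v ^ 2 = 0 := by
  linear_combination (c + d - 2 * Complex.I * v) * hc + v ^ 2 * Complex.I_sq

lemma norm_ofReal_add_I_mul_le (a b : ℝ) : ‖(a : ℂ) + Complex.I * b‖ ≤ |a| + |b| := by
  refine (norm_add_le _ _).trans ?_
  simp

/-- Lemma 2.1 of the paper: Taylor expansion of the spectrum of
`A₁(r)` for small `r`. There are three distinct eigenvalues
`λ₁,₂ = −((β₁β₃ν⁺+β₂β₄ν⁻)/(2(β₁β₃+β₂β₄)))r² ± i√(β₁β₃+β₂β₄) r + O(r³)` and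
`λ₃ = −((β₁β₃ν⁻+β₂β₄ν⁺)/(β₁β₃+β₂β₄))r² + O(r³)`. -/
theorem stmt2 (β₁ β₂ β₃ β₄ νp νm : ℝ)
    (hβ₁ : 0 < β₁) (hβ₂ : 0 < β₂) (hβ₃ : 0 < β₃) (hβ₄ : 0 < β₄)
    (hνp : 0 < νp) (hνm : 0 < νm) :
    ∃ η > (0:ℝ), ∃ C > (0:ℝ), ∀ r : ℝ, 0 < r → r ≤ η →
      ∃ l₁ l₂ l₃ : ℂ,
        l₁ ≠ l₂ ∧ l₁ ≠ l₃ ∧ l₂ ≠ l₃ ∧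
        Matrix.det (l₁ • (1 : Matrix (Fin 3) (Fin 3) ℂ) - A1 β₁ β₂ β₃ β₄ νp νm r) = 0 ∧
        Matrix.det (l₂ • (1 : Matrix (Fin 3) (Fin 3) ℂ) - A1 β₁ β₂ β₃ β₄ νp νm r) = 0 ∧
        Matrix.det (l₃ • (1 : Matrix (Fin 3) (Fin 3) ℂ) - A1 β₁ β₂ β₃ β₄ νp νm r) = 0 ∧
        ‖l₁ - (Complex.ofReal (-((β₁ * β₃ * νp + β₂ * β₄ * νm)
                / (2 * (β₁ * β₃ + β₂ * β₄))) * r ^ 2)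
              + Complex.I * Complex.ofReal (Real.sqrt (β₁ * β₃ + β₂ * β₄) * r))‖
            ≤ C * r ^ 3 ∧
        ‖l₂ - (Complex.ofReal (-((β₁ * β₃ * νp + β₂ * β₄ * νm)
                / (2 * (β₁ * β₃ + β₂ * β₄))) * r ^ 2)
              - Complex.I * Complex.ofReal (Real.sqrt (β₁ * β₃ + β₂ * β₄) * r))‖
            ≤ C * r ^ 3 ∧
        ‖l₃ - Complex.ofReal (-((β₁ * β₃ * νm + β₂ * β₄ * νp)
                / (β₁ * β₃ + β₂ * β₄)) * r ^ 2)‖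
            ≤ C * r ^ 3 := by
  obtain ⟨s, hs⟩ : ∃ s, s = β₁ * β₃ + β₂ * β₄ := ⟨_, rfl⟩
  have ha : 0 < β₁ * β₃ := mul_pos hβ₁ hβ₃
  have hb : 0 < β₂ * β₄ := mul_pos hβ₂ hβ₄
  have hs0 : 0 < s := by linarith
  obtain ⟨T, hT⟩ : ∃ T, νp + νm + 1 = T := ⟨_, rfl⟩
  have hT1 : 1 ≤ T := by linarith
  have hT0 : 0 < T := by linarith
  obtain ⟨x₀, hx₀⟩ : ∃ x₀, x₀ = -((β₁ * β₃ * νm + β₂ * β₄ * νp) / s) := ⟨_, rfl⟩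
  have hsx₀ : s * x₀ = -(β₁ * β₃ * νm + β₂ * β₄ * νp) := by rw [hx₀]; field_simp
  have hmean : -((β₁ * β₃ * νp + β₂ * β₄ * νm) / (2 * s)) = -(νp + νm + x₀) / 2 := by
    rw [hx₀, hs]; field_simp; ring
  have hu : x₀ ≤ 0 := by
    rw [hx₀, neg_nonpos]; positivity
  have hl : -(νp + νm) ≤ x₀ := by
    rw [hx₀, neg_le_neg_iff, div_le_iff₀ hs0, hs]
    nlinarith [mul_pos ha hνp, mul_pos hb hνm]
  have hrs : 0 < √s := Real.sqrt_pos.2 hs0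
  refine ⟨min 1 (min (s / T ^ 3) (s / (6 * T ^ 2))), by positivity,
    T ^ 3 / s + 3 * T ^ 2 / √s, by positivity, fun r hr hrη => ?_⟩
  rw [le_min_iff, le_min_iff, le_div_iff₀ (by positivity), le_div_iff₀ (by positivity)] at hrη
  obtain ⟨hr1, hrK, hrN⟩ := hrη
  have hr2 : r ^ 2 ≤ r := by nlinarith
  have hr43 : r ^ 4 ≤ r ^ 3 := pow_le_pow_of_le_one hr.le hr1 (by norm_num)
  have hεT : T ^ 3 / s * r ^ 2 ≤ 1 := by
    rw [div_mul_eq_mul_div, div_le_one hs0]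
    nlinarith [pow_pos hT0 3]
  obtain ⟨x, hx, hroot⟩ :=
    exists_root_perturbed_linear hs0 hT1 hνp hνm hT hl hu (sq_nonneg r) hεT
  obtain ⟨hx1, hx2⟩ := abs_le.1 (hx.trans hεT)
  obtain ⟨q, hq⟩ : ∃ q, q = νp + νm + x := ⟨_, rfl⟩
  obtain ⟨E, hE⟩ : ∃ E, E = νp * νm + x * q - q ^ 2 / 4 := ⟨_, rfl⟩
  have hxT : |x| ≤ T := abs_le.2 ⟨by linarith, by linarith⟩
  have hqT : |q| ≤ T := abs_le.2 ⟨by linarith, by linarith⟩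
  have hEN : |E| ≤ 3 * T ^ 2 := by
    have h1 : |x * q| ≤ T * T := by rw [abs_mul]; gcongr
    have h2 : q ^ 2 ≤ T ^ 2 := sq_le_sq' (abs_le.1 hqT).1 (abs_le.1 hqT).2
    have h3 : νp * νm ≤ T * T := by gcongr <;> linarith
    have h4 : 0 < νp * νm := mul_pos hνp hνm
    obtain ⟨h5, h6⟩ := abs_le.1 h1
    rw [abs_le]
    constructor <;> nlinarith [sq_nonneg q]
  have hrE : |r ^ 2 * E| ≤ r ^ 2 * (3 * T ^ 2) := by
    rw [abs_mul, abs_of_nonneg (sq_nonneg r)]; gcongr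
  have hu0 : 0 < s + r ^ 2 * E := by
    have : r ^ 2 * (6 * T ^ 2) ≤ s := le_trans (by gcongr) hrN
    linarith [(abs_le.1 hrE).1]
  obtain ⟨w, hw⟩ : ∃ w, w = √(s + r ^ 2 * E) := ⟨_, rfl⟩
  have hw0 : 0 < w := hw ▸ Real.sqrt_pos.2 hu0
  have hwsq : w ^ 2 = s + r ^ 2 * E := hw ▸ Real.sq_sqrt hu0.le
  have hwerr : |w - √s| ≤ r ^ 2 * (3 * T ^ 2) / √s := by
    rw [hw]
    refine (abs_sqrt_sub_sqrt_le hu0.le hs0).trans ?_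
    gcongr
    simpa using hrE
  have hrw : 0 < w * r := mul_pos hw0 hr
  have herr : |-(x - x₀) / 2 * r ^ 2| + |(w - √s) * r|
      ≤ (T ^ 3 / s + 3 * T ^ 2 / √s) * r ^ 3 := by
    have h1 : |-(x - x₀) / 2 * r ^ 2| ≤ T ^ 3 / s * r ^ 3 := by
      rw [abs_mul, abs_div, abs_neg, abs_of_nonneg (sq_nonneg r), abs_two]
      have : |x - x₀| / 2 ≤ T ^ 3 / s * r ^ 2 := by linarith [abs_nonneg (x - x₀)]
      calc |x - x₀| / 2 * r ^ 2 ≤ T ^ 3 / s * r ^ 2 * r ^ 2 := by gcongr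
        _ = T ^ 3 / s * r ^ 4 := by ring
        _ ≤ T ^ 3 / s * r ^ 3 := by gcongr
    have h2 : |(w - √s) * r| ≤ 3 * T ^ 2 / √s * r ^ 3 := by
      rw [abs_mul, abs_of_pos hr]
      calc |w - √s| * r ≤ r ^ 2 * (3 * T ^ 2) / √s * r := by gcongr
        _ = 3 * T ^ 2 / √s * r ^ 3 := by ring
    linarith
  have hrootC : (r : ℂ) ^ 2 * (x * (x + νp) * (x + νm)) + s * x
      + (β₁ * β₃ * νm + β₂ * β₄ * νp) = 0 := by
    have : r ^ 2 * (x * (x + νp) * (x + νm)) + s * x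
      + (β₁ * β₃ * νm + β₂ * β₄ * νp) = 0 := by linear_combination hroot + hsx₀
    exact_mod_cast this
  have hsC : (s : ℂ) = β₁ * β₃ + β₂ * β₄ := by exact_mod_cast hs
  have hqC : (q : ℂ) = νp + νm + x := by exact_mod_cast hq
  have hwC : (w : ℂ) ^ 2 = s + r ^ 2 * (νp * νm + x * q - q ^ 2 / 4) := by
    rw [hE] at hwsq; exact_mod_cast hwsq
  have hdet := fun l => (det_smul_one_sub_A1 β₁ β₂ β₃ β₄ νp νm r l).trans
    (cubic_eq_mul_quadratic hsC hqC hwC hrootC)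
  rw [← hs, hmean, ← hx₀]
  have im_add : ∀ c v : ℝ, ((c : ℂ) + Complex.I * v).im = v := by simp
  have im_sub : ∀ c v : ℝ, ((c : ℂ) - Complex.I * v).im = -v := by simp
  refine ⟨((-q / 2 * r ^ 2 : ℝ) : ℂ) + Complex.I * ((w * r : ℝ) : ℂ),
    ((-q / 2 * r ^ 2 : ℝ) : ℂ) - Complex.I * ((w * r : ℝ) : ℂ), ((x * r ^ 2 : ℝ) : ℂ),
    ?_, ?_, ?_, ?_, ?_, ?_, ?_, ?_, ?_⟩
  · intro h
    linarith [im_add (-q / 2 * r ^ 2) (w * r), im_sub (-q / 2 * r ^ 2) (w * r),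
      congrArg Complex.im h]
  · intro h
    linarith [im_add (-q / 2 * r ^ 2) (w * r), congrArg Complex.im h,
      Complex.ofReal_im (x * r ^ 2)]
  · intro h
    linarith [im_sub (-q / 2 * r ^ 2) (w * r), congrArg Complex.im h,
      Complex.ofReal_im (x * r ^ 2)]
  · rw [hdet, ← Complex.ofReal_mul, add_I_mul_quadratic (by push_cast; ring), mul_zero]
  · rw [hdet, ← Complex.ofReal_mul, sub_I_mul_quadratic (by push_cast; ring), mul_zero]
  · rw [hdet, show ((x * r ^ 2 : ℝ) : ℂ) - x * r ^ 2 = 0 by push_cast; ring, zero_mul]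
  · refine le_trans (le_of_eq_of_le ?_ (norm_ofReal_add_I_mul_le _ _)) herr
    congr 1
    rw [hq]
    push_cast
    ring
  · rw [← abs_neg ((w - √s) * r)] at herr
    refine le_trans (le_of_eq_of_le ?_ (norm_ofReal_add_I_mul_le _ _)) herr
    congr 1
    rw [hq]
    push_cast
    ring
  · rw [← Complex.ofReal_sub, Complex.norm_real, Real.norm_eq_abs, ← sub_mul, abs_mul,
      abs_of_nonneg (sq_nonneg r)]
    calc |x - x₀| * r ^ 2 ≤ T ^ 3 / s * r ^ 2 * r ^ 2 := by gcongr
      _ = T ^ 3 / s * r ^ 4 := by ring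
      _ ≤ T ^ 3 / s * r ^ 3 := by gcongr
      _ ≤ (T ^ 3 / s + 3 * T ^ 2 / √s) * r ^ 3 := by
        gcongr
        exact le_add_of_nonneg_right (by positivity)
end
end

section
/- There exist η > 0 and C > 0 such that for 0 < r ≤ η, the spectral projections P_k(r) = ∏_{j≠k} (A₁(r) − λ_j(r)I)/(λ_k(r) − λ_j(r)) (k = 1,2,3, where λ₁,λ₂,λ₃ are the three distinct eigenvalues of A₁(r)) satisfy ‖P₁(r) − Π₁‖ ≤ Cr, ‖P₂(r) − Π₂‖ ≤ Cr, ‖P₃(r) − Π₃‖ ≤ Cr, where, with b := β₁β₃+β₂β₄, Π₁ has rows (1/2, iβ₁/(2√b), iβ₂/(2√b)), (−iβ₃/(2√b), β₁β₃/(2b), β₂β₃/(2b)), (−iβ₄/(2√b), β₁β₄/(2b), β₂β₄/(2b)); Π₂ is the complex conjugate pattern with rows (1/2, −iβ₁/(2√b), −iβ₂/(2√b)), (iβ₃/(2√b), β₁β₃/(2b), β₂β₃/(2b)), (iβ₄/(2√b), β₁β₄/(2b), β₂β₄/(2b)); and Π₃ has rows (0, 0, 0), (0, β₂β₄/b, −β₂β₃/b),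 (0, −β₁β₄/b, β₁β₃/b). -/
noncomputable section

/-- The spectral projector `P_k = ∏_{j≠k} (A − λ_j I)/(λ_k − λ_j)`. -/
def specProj (A : Matrix (Fin 3) (Fin 3) ℂ) (lk lj1 lj2 : ℂ) : Matrix (Fin 3) (Fin 3) ℂ :=
  ((lk - lj1)⁻¹ * (lk - lj2)⁻¹) •
    ((A - lj1 • (1 : Matrix (Fin 3) (Fin 3) ℂ)) * (A - lj2 • (1 : Matrix (Fin 3) (Fin 3) ℂ)))

/-- Leading term `Π₁` of the projector `P₁(ξ)`. -/
def Pi1 (β₁ β₂ β₃ β₄ : ℝ) : Matrix (Fin 3) (Fin 3) ℂ :=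
  !![Complex.ofReal (1/2),
     Complex.I * Complex.ofReal (β₁ / (2 * Real.sqrt (β₁*β₃+β₂*β₄))),
     Complex.I * Complex.ofReal (β₂ / (2 * Real.sqrt (β₁*β₃+β₂*β₄)));
     -(Complex.I * Complex.ofReal (β₃ / (2 * Real.sqrt (β₁*β₃+β₂*β₄)))),
     Complex.ofReal (β₁*β₃ / (2*(β₁*β₃+β₂*β₄))),
     Complex.ofReal (β₂*β₃ / (2*(β₁*β₃+β₂*β₄)));
     -(Complex.I * Complex.ofReal (β₄ / (2 * Real.sqrt (β₁*β₃+β₂*β₄)))),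
     Complex.ofReal (β₁*β₄ / (2*(β₁*β₃+β₂*β₄))),
     Complex.ofReal (β₂*β₄ / (2*(β₁*β₃+β₂*β₄)))]

/-- Leading term `Π₂` of the projector `P₂(ξ)`. -/
def Pi2 (β₁ β₂ β₃ β₄ : ℝ) : Matrix (Fin 3) (Fin 3) ℂ :=
  !![Complex.ofReal (1/2),
     -(Complex.I * Complex.ofReal (β₁ / (2 * Real.sqrt (β₁*β₃+β₂*β₄)))),
     -(Complex.I * Complex.ofReal (β₂ / (2 * Real.sqrt (β₁*β₃+β₂*β₄))));
     Complex.I * Complex.ofReal (β₃ / (2 * Real.sqrt (β₁*β₃+β₂*β₄))),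
     Complex.ofReal (β₁*β₃ / (2*(β₁*β₃+β₂*β₄))),
     Complex.ofReal (β₂*β₃ / (2*(β₁*β₃+β₂*β₄)));
     Complex.I * Complex.ofReal (β₄ / (2 * Real.sqrt (β₁*β₃+β₂*β₄))),
     Complex.ofReal (β₁*β₄ / (2*(β₁*β₃+β₂*β₄))),
     Complex.ofReal (β₂*β₄ / (2*(β₁*β₃+β₂*β₄)))]

/-- Leading term `Π₃` of the projector `P₃(ξ)`. -/
def Pi3 (β₁ β₂ β₃ β₄ : ℝ) : Matrix (Fin 3) (Fin 3) ℂ :=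
  !![0, 0, 0;
     0, Complex.ofReal (β₂*β₄ / (β₁*β₃+β₂*β₄)), -Complex.ofReal (β₂*β₃ / (β₁*β₃+β₂*β₄));
     0, -Complex.ofReal (β₁*β₄ / (β₁*β₃+β₂*β₄)), Complex.ofReal (β₁*β₃ / (β₁*β₃+β₂*β₄))]

open Filter Topology Asymptotics

/-- `f r = c + O(r)` as `r → 0⁺`. -/
def HasLimitO {F : Type*} [NormedAddCommGroup F] (f : ℝ → F) (c : F) : Prop :=
  (fun r => f r - c) =O[𝓝[>] (0 : ℝ)] (fun r => r)

namespace HasLimitO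

theorem const {F : Type*} [NormedAddCommGroup F] (c : F) : HasLimitO (fun _ => c) c := by
  simpa [HasLimitO] using isBigO_zero (fun r : ℝ => r) (𝓝[>] (0 : ℝ))

theorem add {F : Type*} [NormedAddCommGroup F] {f g : ℝ → F} {a b : F}
    (hf : HasLimitO f a) (hg : HasLimitO g b) : HasLimitO (fun r => f r + g r) (a + b) :=
  (IsBigO.add hf hg).congr_left fun _ => (add_sub_add_comm _ _ _ _).symm

theorem neg {F : Type*} [NormedAddCommGroup F] {f : ℝ → F} {a : F}
    (hf : HasLimitO f a) : HasLimitO (fun r => -f r) (-a) :=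
  (IsBigO.neg_left hf).congr_left fun _ => neg_sub' _ _

theorem sub {F : Type*} [NormedAddCommGroup F] {f g : ℝ → F} {a b : F}
    (hf : HasLimitO f a) (hg : HasLimitO g b) : HasLimitO (fun r => f r - g r) (a - b) :=
  (IsBigO.sub hf hg).congr_left fun _ => sub_sub_sub_comm _ _ _ _

theorem tendsto {F : Type*} [NormedAddCommGroup F] {f : ℝ → F} {a : F}
    (hf : HasLimitO f a) : Tendsto f (𝓝[>] 0) (𝓝 a) :=
  tendsto_sub_nhds_zero_iff.1 <| hf.trans_tendsto <| tendsto_nhdsWithin_of_tendsto_nhds tendsto_id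

theorem comp {F G : Type*} [NormedAddCommGroup F] [NormedSpace ℝ F] [NormedAddCommGroup G]
    [NormedSpace ℝ G] {f : ℝ → F} {a : F} {g : F → G}
    (hg : DifferentiableAt ℝ g a) (hf : HasLimitO f a) : HasLimitO (fun r => g (f r)) (g a) :=
  (hg.isBigO_sub.comp_tendsto hf.tendsto).trans hf

theorem mul {F : Type*} [NormedRing F] [NormedAlgebra ℝ F] {f g : ℝ → F} {a b : F}
    (hf : HasLimitO f a) (hg : HasLimitO g b) : HasLimitO (fun r => f r * g r) (a * b) :=
  comp (g := fun p : F × F => p.1 * p.2) (a := (a, b)) (f := fun r => (f r, g r))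
    (by fun_prop) (IsBigO.prod_left hf hg)

theorem inv {f : ℝ → ℂ} {a : ℂ} (ha : a ≠ 0) (hf : HasLimitO f a) :
    HasLimitO (fun r => (f r)⁻¹) a⁻¹ :=
  comp (g := fun z : ℂ => z⁻¹) (by fun_prop (disch := exact ha)) hf

theorem ofReal {f : ℝ → ℝ} {a : ℝ} (hf : HasLimitO f a) : HasLimitO (fun r => (f r : ℂ)) a :=
  comp (g := Complex.ofReal) Complex.ofRealCLM.differentiableAt hf

theorem id : HasLimitO (fun r : ℝ => r) 0 := by
  simpa [HasLimitO] using isBigO_refl (fun r : ℝ => r) (𝓝[>] (0 : ℝ))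

theorem specProj {M : ℝ → Matrix (Fin 3) (Fin 3) ℂ} {M₀ : Matrix (Fin 3) (Fin 3) ℂ}
    {x y z : ℝ → ℂ} {x₀ y₀ z₀ : ℂ} (hM : ∀ i j, HasLimitO (fun r => M r i j) (M₀ i j))
    (hx : HasLimitO x x₀) (hy : HasLimitO y y₀) (hz : HasLimitO z z₀)
    (hxy : x₀ ≠ y₀) (hxz : x₀ ≠ z₀) (i j : Fin 3) :
    HasLimitO (fun r => _root_.specProj (M r) (x r) (y r) (z r) i j)
      (_root_.specProj M₀ x₀ y₀ z₀ i j) := by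
  have hsub : ∀ {w : ℝ → ℂ} {w₀ : ℂ}, HasLimitO w w₀ → ∀ i j,
      HasLimitO (fun r => (M r - w r • (1 : Matrix (Fin 3) (Fin 3) ℂ)) i j)
        ((M₀ - w₀ • (1 : Matrix (Fin 3) (Fin 3) ℂ)) i j) := fun hw i j =>
    (hM i j).sub (hw.mul (const _))
  simp only [_root_.specProj, Matrix.smul_apply, Matrix.mul_apply, Fin.sum_univ_three, smul_eq_mul]
  exact (((hx.sub hy).inv (sub_ne_zero.2 hxy)).mul ((hx.sub hz).inv (sub_ne_zero.2 hxz))).mul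
    ((((hsub hy _ _).mul (hsub hz _ _)).add ((hsub hy _ _).mul (hsub hz _ _))).add
      ((hsub hy _ _).mul (hsub hz _ _)))

end HasLimitO

theorem specProj_smul {c : ℂ} (hc : c ≠ 0) (A : Matrix (Fin 3) (Fin 3) ℂ) (x y z : ℂ) :
    specProj (c • A) (c * x) (c * y) (c * z) = specProj A x y z := by
  have h : ∀ w : ℂ, c • A - (c * w) • (1 : Matrix (Fin 3) (Fin 3) ℂ) = c • (A - w • 1) := by
    intro w; rw [smul_sub, smul_smul]
  simp only [specProj, h, ← mul_sub, mul_inv, Matrix.smul_mul, Matrix.mul_smul, smul_smul]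
  congr 1
  field_simp

/-- The rescaled matrix `A₁(r) / r`. -/
def scaledA1 (β₁ β₂ β₃ β₄ νp νm : ℝ) (r : ℝ) : Matrix (Fin 3) (Fin 3) ℂ :=
  !![0, -β₁, -β₂; β₃, -(νp * r : ℝ), 0; β₄, 0, -(νm * r : ℝ)]

theorem A1_eq_smul (β₁ β₂ β₃ β₄ νp νm r : ℝ) :
    A1 β₁ β₂ β₃ β₄ νp νm r = (r : ℂ) • scaledA1 β₁ β₂ β₃ β₄ νp νm r := by
  ext i j
  fin_cases i <;> fin_cases j <;> simp [A1, scaledA1] <;> ring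

theorem hasLimitO_scaledA1 (β₁ β₂ β₃ β₄ νp νm : ℝ) (i j : Fin 3) :
    HasLimitO (fun r => scaledA1 β₁ β₂ β₃ β₄ νp νm r i j)
      (scaledA1 β₁ β₂ β₃ β₄ νp νm 0 i j) := by
  have h : ∀ ν : ℝ, HasLimitO (fun r => (-(ν * r : ℝ) : ℂ)) (-(ν * 0 : ℝ)) := fun ν =>
    ((HasLimitO.const ν).mul HasLimitO.id).ofReal.neg
  fin_cases i <;> fin_cases j <;>
    first
    | exact HasLimitO.const _
    | exact h _

theorem det_A1 (β₁ β₂ β₃ β₄ νp νm r : ℝ) (μ : ℂ) :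
    Matrix.det ((r * μ) • (1 : Matrix (Fin 3) (Fin 3) ℂ) - A1 β₁ β₂ β₃ β₄ νp νm r) =
      r ^ 3 * (μ * (μ + νp * r) * (μ + νm * r) + β₁ * β₃ * (μ + νm * r)
        + β₂ * β₄ * (μ + νp * r)) := by
  simp [Matrix.det_fin_three, A1]
  ring

section LeadingTerms

variable {β₁ β₂ β₃ β₄ s : ℝ} (νp νm : ℝ)

theorem specProj_eq_Pi1 (hs : 0 < s) (h : s ^ 2 = β₁ * β₃ + β₂ * β₄) :
    specProj (scaledA1 β₁ β₂ β₃ β₄ νp νm 0) (Complex.I * s) (-(Complex.I * s)) 0 =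
      Pi1 β₁ β₂ β₃ β₄ := by
  have hs' : Real.sqrt (β₁ * β₃ + β₂ * β₄) = s := by rw [← h, Real.sqrt_sq hs.le]
  have hc : (s : ℂ) ≠ 0 := by exact_mod_cast hs.ne'
  have hc2 : (s : ℂ) ^ 2 = β₁ * β₃ + β₂ * β₄ := by exact_mod_cast h
  have hI := Complex.I_sq
  ext i j
  rw [Pi1, hs', ← h]
  fin_cases i <;> fin_cases j <;>
    simp [specProj, scaledA1, Matrix.mul_apply, Fin.sum_univ_three] <;> field_simp <;> grind

theorem specProj_eq_Pi2 (hs : 0 < s) (h : s ^ 2 = β₁ * β₃ + β₂ * β₄) :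
    specProj (scaledA1 β₁ β₂ β₃ β₄ νp νm 0) (-(Complex.I * s)) (Complex.I * s) 0 =
      Pi2 β₁ β₂ β₃ β₄ := by
  have hs' : Real.sqrt (β₁ * β₃ + β₂ * β₄) = s := by rw [← h, Real.sqrt_sq hs.le]
  have hc : (s : ℂ) ≠ 0 := by exact_mod_cast hs.ne'
  have hc2 : (s : ℂ) ^ 2 = β₁ * β₃ + β₂ * β₄ := by exact_mod_cast h
  have hI := Complex.I_sq
  ext i j
  rw [Pi2, hs', ← h]
  fin_cases i <;> fin_cases j <;>
    simp [specProj, scaledA1, Matrix.mul_apply, Fin.sum_univ_three] <;> field_simp <;> grind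

theorem specProj_eq_Pi3 (hs : 0 < s) (h : s ^ 2 = β₁ * β₃ + β₂ * β₄) :
    specProj (scaledA1 β₁ β₂ β₃ β₄ νp νm 0) 0 (Complex.I * s) (-(Complex.I * s)) =
      Pi3 β₁ β₂ β₃ β₄ := by
  have hc : (s : ℂ) ≠ 0 := by exact_mod_cast hs.ne'
  have hc2 : (s : ℂ) ^ 2 = β₁ * β₃ + β₂ * β₄ := by exact_mod_cast h
  have hI := Complex.I_sq
  ext i j
  rw [Pi3, ← h]
  fin_cases i <;> fin_cases j <;>
    simp [specProj, scaledA1, Matrix.mul_apply, Fin.sum_univ_three] <;> field_simp <;> grind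

end LeadingTerms

theorem exists_real_root {b₁ b₂ νp νm r : ℝ} (hb₁ : 0 < b₁) (hb₂ : 0 < b₂)
    (hνp : 0 < νp) (hνm : 0 < νm) (hr : 0 ≤ r) :
    ∃ m : ℝ, |m| ≤ (νp + νm) * r ∧
      m * (m + νp * r) * (m + νm * r) + b₁ * (m + νm * r) + b₂ * (m + νp * r) = 0 := by
  have hle : -((νp + νm) * r) ≤ 0 := by simp only [neg_nonpos]; positivity
  have hcont : ContinuousOn (fun m : ℝ =>
      m * (m + νp * r) * (m + νm * r) + b₁ * (m + νm * r) + b₂ * (m + νp * r))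
      (Set.Icc (-((νp + νm) * r)) 0) := by fun_prop
  obtain ⟨m, ⟨hm₁, hm₂⟩, hm⟩ := intermediate_value_Icc hle hcont
    (show (0 : ℝ) ∈ Set.Icc _ _ by
      constructor
      · have : 0 ≤ (νp + νm) * r * (νm * r) * (νp * r) + b₁ * (νp * r) + b₂ * (νm * r) := by
          positivity
        linarith
      · simp only [zero_add, zero_mul]
        positivity)
  exact ⟨m, abs_le.2 ⟨hm₁, by linarith⟩, hm⟩

theorem HasLimitO.isBigO_mul {f : ℝ → ℂ} {c : ℂ} (hf : HasLimitO f c) :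
    (fun r : ℝ => r * f r - r * c) =O[𝓝[>] (0 : ℝ)] (fun r => r ^ 2) := by
  have h : (fun r : ℝ => (r : ℂ)) =O[𝓝[>] (0 : ℝ)] (fun r => r) :=
    .of_bound 1 (Eventually.of_forall fun r => by simp)
  exact (IsBigO.mul h hf).congr (fun r => by ring) (fun r => by ring)

theorem Asymptotics.IsBigO.eventually_norm_le {f : ℝ → ℂ} {g : ℝ → ℝ} (hg : ∀ r, 0 < r → 0 ≤ g r)
    (hf : f =O[𝓝[>] (0 : ℝ)] g) :
    ∀ᶠ C in atTop, ∀ᶠ r in 𝓝[>] (0 : ℝ), ‖f r‖ ≤ C * g r := by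
  filter_upwards [isBigO_iff_eventually.1 hf] with C hC
  filter_upwards [hC, self_mem_nhdsWithin] with r hr hpos
  rwa [Real.norm_of_nonneg (hg r hpos)] at hr

/-- For small `r`, the cubic `det (μ - A₁(r) / r)` has a real root and a conjugate pair of
nonreal roots, depending on `r` to within `O(r)`. -/
theorem exists_roots {b₁ b₂ νp νm s : ℝ} (hb₁ : 0 < b₁) (hb₂ : 0 < b₂)
    (hνp : 0 < νp) (hνm : 0 < νm) (hs : 0 < s) (h : s ^ 2 = b₁ + b₂) :
    ∃ m u w : ℝ → ℝ, HasLimitO m 0 ∧ HasLimitO u 0 ∧ HasLimitO w s ∧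
      ∀ᶠ r in 𝓝[>] (0 : ℝ), 0 < w r ∧ ∀ μ : ℂ,
        μ * (μ + νp * r) * (μ + νm * r) + b₁ * (μ + νm * r) + b₂ * (μ + νp * r) =
          (μ - m r) * (μ - (u r + Complex.I * w r)) * (μ - (u r - Complex.I * w r)) := by
  have hroot := fun r : ℝ => exists_real_root hb₁ hb₂ hνp hνm (abs_nonneg r)
  choose m hm hm0 using hroot
  have hmO : HasLimitO m 0 := by
    refine .of_bound (νp + νm) (Eventually.of_forall fun r => ?_)
    simpa using hm r
  have hlin : ∀ ν : ℝ, HasLimitO (fun r => ν * r) 0 := fun ν => by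
    simpa using (HasLimitO.const ν).mul HasLimitO.id
  let p : ℝ → ℝ := fun r => (νp + νm) * r + m r
  have hp : HasLimitO p 0 := by simpa using (hlin (νp + νm)).add hmO
  have hu : HasLimitO (fun r => -(1 / 2) * p r) 0 := by
    simpa using (HasLimitO.const (-(1 / 2) : ℝ)).mul hp
  let d : ℝ → ℝ := fun r =>
    s ^ 2 + (νp * r) * (νm * r) + m r * p r - (-(1 / 2) * p r) * (-(1 / 2) * p r)
  have hd : HasLimitO d (s ^ 2) := by
    have hd' : HasLimitO d (s ^ 2 + 0 * 0 + 0 * 0 - 0 * 0) :=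
      (((HasLimitO.const (s ^ 2)).add ((hlin νp).mul (hlin νm))).add
        (hmO.mul hp)).sub (hu.mul hu)
    simpa only [mul_zero, add_zero, sub_zero] using hd'
  have hw : HasLimitO (fun r => Real.sqrt (d r)) s := by
    simpa [Real.sqrt_sq hs.le] using
      HasLimitO.comp (g := Real.sqrt) (Real.hasDerivAt_sqrt (pow_pos hs 2).ne').differentiableAt hd
  refine ⟨m, _, _, hmO, hu, hw, ?_⟩
  filter_upwards [hd.tendsto.eventually_const_lt (pow_pos hs 2), self_mem_nhdsWithin]
    with r hdr hr
  refine ⟨Real.sqrt_pos.2 hdr, fun μ => ?_⟩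
  have hsq : ((Real.sqrt (d r) : ℝ) : ℂ) ^ 2 = (d r : ℝ) := by
    exact_mod_cast Real.sq_sqrt hdr.le
  have hroot := hm0 r
  rw [abs_of_pos hr] at hroot
  have hrootC : (m r : ℂ) * (m r + νp * r) * (m r + νm * r) + b₁ * (m r + νm * r)
      + b₂ * (m r + νp * r) = 0 := by exact_mod_cast hroot
  have hC : (s : ℂ) ^ 2 = b₁ + b₂ := by exact_mod_cast h
  generalize Real.sqrt (d r) = w at hsq
  simp only [d, p] at hsq ⊢
  push_cast at hsq ⊢
  linear_combination (-(μ - m r)) * hsq + hrootC - (μ - m r) * hC + (μ - m r) * w ^ 2 * Complex.I_sq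

/-- expansions (2.21)–(2.23) of the paper: for small `r`, the spectral
projections of `A₁(r)` (with the eigenvalues labelled so that `λ₁,λ₂` are the oscillatory
ones, `λ₁ = i√(β₁β₃+β₂β₄)r + O(r²)`, `λ₂ = −i√(β₁β₃+β₂β₄)r + O(r²)`, and `λ₃` is real
with `λ₃ = O(r²)`) satisfy `P_k(r) = Π_k + O(r)` (entrywise). -/
theorem stmt3 (β₁ β₂ β₃ β₄ νp νm : ℝ)
    (hβ₁ : 0 < β₁) (hβ₂ : 0 < β₂) (hβ₃ : 0 < β₃) (hβ₄ : 0 < β₄)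
    (hνp : 0 < νp) (hνm : 0 < νm) :
    ∃ η > (0:ℝ), ∃ C > (0:ℝ), ∃ l₁ l₂ l₃ : ℝ → ℂ, ∀ r : ℝ, 0 < r → r ≤ η →
      (Matrix.det (l₁ r • (1 : Matrix (Fin 3) (Fin 3) ℂ) - A1 β₁ β₂ β₃ β₄ νp νm r) = 0) ∧
      (Matrix.det (l₂ r • (1 : Matrix (Fin 3) (Fin 3) ℂ) - A1 β₁ β₂ β₃ β₄ νp νm r) = 0) ∧
      (Matrix.det (l₃ r • (1 : Matrix (Fin 3) (Fin 3) ℂ) - A1 β₁ β₂ β₃ β₄ νp νm r) = 0) ∧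
      l₁ r ≠ l₂ r ∧ l₁ r ≠ l₃ r ∧ l₂ r ≠ l₃ r ∧
      ‖l₁ r - Complex.I * Complex.ofReal (Real.sqrt (β₁*β₃+β₂*β₄) * r)‖ ≤ C * r ^ 2 ∧
      ‖l₂ r + Complex.I * Complex.ofReal (Real.sqrt (β₁*β₃+β₂*β₄) * r)‖ ≤ C * r ^ 2 ∧
      (l₃ r).im = 0 ∧ ‖l₃ r‖ ≤ C * r ^ 2 ∧
      (∀ i j : Fin 3,
        ‖specProj (A1 β₁ β₂ β₃ β₄ νp νm r) (l₁ r) (l₂ r) (l₃ r) i j - Pi1 β₁ β₂ β₃ β₄ i j‖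
          ≤ C * r) ∧
      (∀ i j : Fin 3,
        ‖specProj (A1 β₁ β₂ β₃ β₄ νp νm r) (l₂ r) (l₁ r) (l₃ r) i j - Pi2 β₁ β₂ β₃ β₄ i j‖
          ≤ C * r) ∧
      (∀ i j : Fin 3,
        ‖specProj (A1 β₁ β₂ β₃ β₄ νp νm r) (l₃ r) (l₁ r) (l₂ r) i j - Pi3 β₁ β₂ β₃ β₄ i j‖
          ≤ C * r) := by
  have hb₁ := mul_pos hβ₁ hβ₃
  have hb₂ := mul_pos hβ₂ hβ₄
  have hb := add_pos hb₁ hb₂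
  set s := Real.sqrt (β₁ * β₃ + β₂ * β₄) with hsdef
  have hs : 0 < s := Real.sqrt_pos.2 hb
  have hs2 : s ^ 2 = β₁ * β₃ + β₂ * β₄ := Real.sq_sqrt hb.le
  obtain ⟨m, u, w, hm, hu, hw, hroots⟩ := exists_roots hb₁ hb₂ hνp hνm hs hs2
  have hIw := (HasLimitO.const Complex.I).mul hw.ofReal
  have h₁ : HasLimitO (fun r => (u r + Complex.I * w r : ℂ)) (Complex.I * s) := by
    simpa using hu.ofReal.add hIw
  have h₂ : HasLimitO (fun r => (u r - Complex.I * w r : ℂ)) (-(Complex.I * s)) := by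
    simpa using hu.ofReal.sub hIw
  have h₃ : HasLimitO (fun r => (m r : ℂ)) 0 := by simpa using hm.ofReal
  have hs₀ : Complex.I * s ≠ 0 := by simp [hs.ne']
  have hss : Complex.I * s ≠ -(Complex.I * s) := fun h => hs₀ (self_eq_neg.1 h)
  have hA := hasLimitO_scaledA1 β₁ β₂ β₃ β₄ νp νm
  have hP₁ := HasLimitO.specProj hA h₁ h₂ h₃ hss hs₀
  have hP₂ := HasLimitO.specProj hA h₂ h₁ h₃ hss.symm (neg_ne_zero.2 hs₀)
  have hP₃ := HasLimitO.specProj hA h₃ h₁ h₂ hs₀.symm (neg_ne_zero.2 hs₀).symm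
  rw [specProj_eq_Pi1 νp νm hs hs2] at hP₁
  rw [specProj_eq_Pi2 νp νm hs hs2] at hP₂
  rw [specProj_eq_Pi3 νp νm hs hs2] at hP₃
  have hid : ∀ r : ℝ, 0 < r → 0 ≤ r := fun r hr => hr.le
  have hsq : ∀ r : ℝ, 0 < r → 0 ≤ r ^ 2 := fun r _ => sq_nonneg r
  obtain ⟨C, hC, e₁, e₂, e₃, f₁, f₂, f₃⟩ := ((eventually_gt_atTop (0 : ℝ)).and <|
    (h₁.isBigO_mul.eventually_norm_le hsq).and <| (h₂.isBigO_mul.eventually_norm_le hsq).and <|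
    (h₃.isBigO_mul.eventually_norm_le hsq).and <|
    (eventually_all.2 fun i => eventually_all.2 fun j => (hP₁ i j).eventually_norm_le hid).and <|
    (eventually_all.2 fun i => eventually_all.2 fun j => (hP₂ i j).eventually_norm_le hid).and <|
    (eventually_all.2 fun i => eventually_all.2 fun j =>
      (hP₃ i j).eventually_norm_le hid)).exists
  simp only [← eventually_all] at f₁ f₂ f₃
  obtain ⟨η, hη, hall⟩ := mem_nhdsGT_iff_exists_Ioc_subset.1
    (hroots.and <| e₁.and <| e₂.and <| e₃.and <| f₁.and <| f₂.and f₃)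
  refine ⟨η, hη, C, hC, fun r => r * (u r + Complex.I * w r), fun r => r * (u r - Complex.I * w r),
    fun r => r * m r, fun r hr hrη => ?_⟩
  obtain ⟨⟨hwr, hfac⟩, g₁, g₂, g₃, k₁, k₂, k₃⟩ := hall ⟨hr, hrη⟩
  have hrC : (r : ℂ) ≠ 0 := by exact_mod_cast hr.ne'
  have hdet : ∀ μ : ℂ, (μ - m r) * (μ - (u r + Complex.I * w r)) *
      (μ - (u r - Complex.I * w r)) = 0 →
      Matrix.det ((r * μ) • (1 : Matrix (Fin 3) (Fin 3) ℂ) - A1 β₁ β₂ β₃ β₄ νp νm r) = 0 := by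
    intro μ hμ
    have := hfac μ
    push_cast at this
    rw [det_A1, this, hμ, mul_zero]
  have hne : ∀ x y : ℂ, x.im ≠ y.im → (r : ℂ) * x ≠ r * y := fun x y hxy h =>
    hxy (congrArg Complex.im (mul_left_cancel₀ hrC h))
  simp only [A1_eq_smul _ _ _ _ _ _ r, specProj_smul hrC]
  simp only [← A1_eq_smul]
  refine ⟨hdet _ (by ring), hdet _ (by ring), hdet _ (by ring), hne _ _ ?_, hne _ _ ?_, hne _ _ ?_,
    ?_, ?_, ?_, ?_, k₁, k₂, k₃⟩
  · simp only [Complex.add_im, Complex.sub_im, Complex.ofReal_im, Complex.im_mul_ofReal,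
      Complex.I_im]
    linarith
  · simpa using hwr.ne'
  · simpa using hwr.ne'
  · convert g₁ using 3
    push_cast
    ring
  · convert g₂ using 2
    push_cast
    ring
  · simp
  · simpa using g₃
end
end
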